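/- Let Ω ⊆ ℝ³ be open, k > 0, and c : Ω → ℝ. Let u, u_i : Ω → ℂ be twice continuously differentiable and nowhere vanishing on Ω, satisfying the Helmholtz equations Δu + k² c(x) u = 0 and Δu_i + k² u_i = 0 on Ω. Let v : Ω → ℂ be twice continuously differentiable with exp(k² v(x)) = u(x)/u_i(x) for all x ∈ Ω. Then for all x ∈ Ω: Δv + k² (∇v · ∇v) + (2/u_i) (∇v · ∇u_i) = 1 − c(x), where ∇v · ∇w = ∂_x v ∂_x w + ∂_y v ∂_y w + ∂_z v ∂_z w denotes the (bilinear, not Hermitian) dot product of complex gradients. -/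

import Mathlib

noncomputable section

abbrev E3 : Type := EuclideanSpace ℝ (Fin 3)

/-- Partial derivative of `W` in the `i`-th coordinate direction. -/
def pd (i : Fin 3) (W : E3 → ℂ) (x : E3) : ℂ :=
  fderiv ℝ W x (EuclideanSpace.single i 1)

/-- The Laplacian of `W`. -/
def lap (W : E3 → ℂ) (x : E3) : ℂ := ∑ i : Fin 3, pd i (pd i W) x

/-- Bilinear (non-Hermitian) dot product of the gradients of `V` and `W`. -/
def dotGrad (V W : E3 → ℂ) (x : E3) : ℂ := ∑ i : Fin 3, pd i V x * pd i W x

theorem pd_congr {V W : E3 → ℂ} {x : E3} (h : V =ᶠ[nhds x] W) (i : Fin 3) :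
    pd i V x = pd i W x := by
  simp only [pd, h.fderiv_eq]

theorem pd_add {V W : E3 → ℂ} {x : E3} (hV : DifferentiableAt ℝ V x)
    (hW : DifferentiableAt ℝ W x) (i : Fin 3) :
    pd i (fun y => V y + W y) x = pd i V x + pd i W x := by
  simp [pd, fderiv_fun_add hV hW]

theorem pd_mul {V W : E3 → ℂ} {x : E3} (hV : DifferentiableAt ℝ V x)
    (hW : DifferentiableAt ℝ W x) (i : Fin 3) :
    pd i (fun y => V y * W y) x = V x * pd i W x + pd i V x * W x := by
  simp [pd, fderiv_fun_mul hV hW, mul_comm]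

theorem pd_const_mul {V : E3 → ℂ} {x : E3} (hV : DifferentiableAt ℝ V x) (a : ℂ) (i : Fin 3) :
    pd i (fun y => a * V y) x = a * pd i V x := by
  simp [pd, fderiv_const_mul hV]

theorem pd_cexp {V : E3 → ℂ} {x : E3} (hV : DifferentiableAt ℝ V x) (i : Fin 3) :
    pd i (fun y => Complex.exp (V y)) x = Complex.exp (V x) * pd i V x := by
  simp [pd, hV.hasFDerivAt.cexp.fderiv]

theorem ContDiffAt.differentiableAt_pd {V : E3 → ℂ} {x : E3} (hV : ContDiffAt ℝ 2 V x)
    (i : Fin 3) : DifferentiableAt ℝ (pd i V) x := by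
  have h : ContDiffAt ℝ 1 (fderiv ℝ V) x := hV.fderiv_right (by norm_num)
  exact (h.differentiableAt (by norm_num)).clm_apply (differentiableAt_const _)

/-- The product rule for `W * exp (a * V)` applied twice and summed over the coordinates. -/
theorem lap_mul_cexp {Ω : Set E3} (hΩ : IsOpen Ω) {V W : E3 → ℂ} (hV : ContDiffOn ℝ 2 V Ω)
    (hW : ContDiffOn ℝ 2 W Ω) (a : ℂ) {x : E3} (hx : x ∈ Ω) :
    lap (fun y => W y * Complex.exp (a * V y)) x =
      Complex.exp (a * V x) * (lap W x + 2 * a * dotGrad V W x + a * W x * lap V x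
        + a ^ 2 * W x * dotGrad V V x) := by
  have cV : ∀ y ∈ Ω, ContDiffAt ℝ 2 V y := fun y hy => hV.contDiffAt (hΩ.mem_nhds hy)
  have cW : ∀ y ∈ Ω, ContDiffAt ℝ 2 W y := fun y hy => hW.contDiffAt (hΩ.mem_nhds hy)
  have dV : ∀ y ∈ Ω, DifferentiableAt ℝ V y := fun y hy => (cV y hy).differentiableAt (by norm_num)
  have dW : ∀ y ∈ Ω, DifferentiableAt ℝ W y := fun y hy => (cW y hy).differentiableAt (by norm_num)
  have daV : ∀ y ∈ Ω, DifferentiableAt ℝ (fun z => a * V z) y := fun y hy => (dV y hy).const_mul a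
  have dE : ∀ y ∈ Ω, DifferentiableAt ℝ (fun z => Complex.exp (a * V z)) y :=
    fun y hy => (daV y hy).cexp
  have first : ∀ i, ∀ y ∈ Ω, pd i (fun z => W z * Complex.exp (a * V z)) y =
      Complex.exp (a * V y) * (pd i W y + a * (W y * pd i V y)) := by
    intro i y hy
    rw [pd_mul (dW y hy) (dE y hy), pd_cexp (daV y hy), pd_const_mul (dV y hy)]
    ring
  have second : ∀ i, pd i (pd i (fun z => W z * Complex.exp (a * V z))) x =
      Complex.exp (a * V x) * (pd i (pd i W) x + 2 * a * (pd i V x * pd i W x)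
        + a * W x * pd i (pd i V) x + a ^ 2 * W x * (pd i V x * pd i V x)) := by
    intro i
    have dpV := (cV x hx).differentiableAt_pd i
    have dpW := (cW x hx).differentiableAt_pd i
    have dm : DifferentiableAt ℝ (fun y => W y * pd i V y) x := (dW x hx).mul dpV
    have dam : DifferentiableAt ℝ (fun y => a * (W y * pd i V y)) x := dm.const_mul a
    have ds : DifferentiableAt ℝ (fun y => pd i W y + a * (W y * pd i V y)) x := dpW.add dam
    rw [pd_congr (Filter.eventually_of_mem (hΩ.mem_nhds hx) (first i)), pd_mul (dE x hx) ds,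
      pd_add dpW dam, pd_const_mul dm, pd_mul (dW x hx) dpV, pd_cexp (daV x hx),
      pd_const_mul (dV x hx)]
    ring
  simp only [lap, dotGrad, second, Fin.sum_univ_three]
  ring

theorem lap_congr {V W : E3 → ℂ} {x : E3} (h : V =ᶠ[nhds x] W) : lap V x = lap W x :=
  Finset.sum_congr rfl fun i _ => pd_congr (h.eventually_nhds.mono fun _ hy => pd_congr hy i) i

/-- The quasilinear PDE satisfied by `v = (1/k²) log(u/u_i)`. -/
theorem pde_for_v (Ω : Set E3) (hΩ : IsOpen Ω) (k : ℝ) (hk : 0 < k) (c : E3 → ℝ)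
    (u ui v : E3 → ℂ)
    (hu : ContDiffOn ℝ 2 u Ω) (hui : ContDiffOn ℝ 2 ui Ω) (hv : ContDiffOn ℝ 2 v Ω)
    (hu0 : ∀ x ∈ Ω, u x ≠ 0) (hui0 : ∀ x ∈ Ω, ui x ≠ 0)
    (hHelm : ∀ x ∈ Ω, lap u x + (k : ℂ)^2 * (c x : ℂ) * u x = 0)
    (hHelmi : ∀ x ∈ Ω, lap ui x + (k : ℂ)^2 * ui x = 0)
    (hvdef : ∀ x ∈ Ω, Complex.exp ((k : ℂ)^2 * v x) = u x / ui x) :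
    ∀ x ∈ Ω,
      lap v x + (k : ℂ)^2 * dotGrad v v x + (2 / ui x) * dotGrad v ui x
        = 1 - (c x : ℂ) := by
  intro x hx
  have hE : ∀ y ∈ Ω, u y = ui y * Complex.exp ((k : ℂ) ^ 2 * v y) := fun y hy => by
    rw [hvdef y hy, mul_div_cancel₀ _ (hui0 y hy)]
  have hlap := (lap_congr (Filter.eventually_of_mem (hΩ.mem_nhds hx) hE)).trans
    (lap_mul_cexp hΩ hv hui _ hx)
  have hu' := hHelm x hx
  have hk0 : (k : ℂ) ≠ 0 := by exact_mod_cast hk.ne'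
  have hui' := hui0 x hx
  rw [hlap, hE x hx, eq_neg_of_add_eq_zero_left (hHelmi x hx)] at hu'
  have hne : (k : ℂ) ^ 2 * Complex.exp ((k : ℂ) ^ 2 * v x) ≠ 0 :=
    mul_ne_zero (pow_ne_zero 2 hk0) (Complex.exp_ne_zero _)
  have key : ui x * lap v x + (k : ℂ) ^ 2 * ui x * dotGrad v v x + 2 * dotGrad v ui x
      = ui x * (1 - c x) :=
    mul_left_cancel₀ hne (by linear_combination hu')
  field_simp
  linear_combination key
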